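/- For a finite MDP with optimal value function V*, let w_L ∈ ℝ^k be such that L = Φw_L is a Lyapunov function with rate β ∈ [0,1) (i.e., L(s) > 0 and γ(HL)(s) ≤ β L(s) for all s ∈ S). For any w ∈ ℝ^k, let ε = ‖V* − Φw‖_{∞,1/L} and w̄ = w + ε · (2/(1−β) − 1) · w_L. Then (T(Φw̄))(s) ≤ (Φw̄)(s) for every state s ∈ S. -/

import Mathlib

open Finset

section Defs

variable {S A : Type*} [Fintype S] [Nonempty S] [Fintype A] [Nonempty A]

/-- The Bellman operator: `(T V)(s) = max_a [R(s) + γ ∑_{s'} P(s'|s,a) V(s')]`. -/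
noncomputable def bellman (P : S → A → S → ℝ) (R : S → ℝ) (γ : ℝ) (V : S → ℝ) (s : S) : ℝ :=
  univ.sup' univ_nonempty fun a => R s + γ * ∑ s', P s a s' * V s'

/-- The operator `H`: `(H L)(s) = max_a ∑_{s'} P(s'|s,a) L(s')`. -/
noncomputable def Hop (P : S → A → S → ℝ) (L : S → ℝ) (s : S) : ℝ :=
  univ.sup' univ_nonempty fun a => ∑ s', P s a s' * L s'

/-- `(Φ w)(s) = ∑ i, Φ_i(s) w_i`. -/
def phiW {k : ℕ} (Φ : S → Fin (k + 1) → ℝ) (w : Fin (k + 1) → ℝ) (s : S) : ℝ :=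
  ∑ i, Φ s i * w i

/-- `‖w‖_{-1}`: the ℓ¹ norm of `w` with the bias coordinate (index 0) excluded. -/
def normNeg1 {k : ℕ} (w : Fin (k + 1) → ℝ) : ℝ :=
  ∑ i ∈ Finset.univ.erase 0, |w i|

/-- The weighted max-norm `‖U‖_{∞,1/L} = max_s |U(s)| / L(s)`. -/
noncomputable def wmaxNorm (L U : S → ℝ) : ℝ :=
  univ.sup' univ_nonempty fun s => |U s| / L s

/-- The weighted L¹ norm `‖U‖_{1,ρ} = ∑_s ρ(s) |U(s)|`. -/
def w1Norm (ρ U : S → ℝ) : ℝ := ∑ s, ρ s * |U s|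

/-- The max-absolute-value norm on functions `S → ℝ`. -/
noncomputable def maxNorm (U : S → ℝ) : ℝ :=
  univ.sup' univ_nonempty fun s => |U s|

/-- RALP feasibility: `‖w‖_{-1} ≤ ψ` and all Bellman (state-action) constraints hold. -/
def RALPfeasible {k : ℕ} (P : S → A → S → ℝ) (R : S → ℝ) (γ : ℝ)
    (Φ : S → Fin (k + 1) → ℝ) (ψ : ℝ) (w : Fin (k + 1) → ℝ) : Prop :=
  normNeg1 w ≤ ψ ∧
    ∀ s a, R s + γ * ∑ s', P s a s' * phiW Φ w s' ≤ phiW Φ w s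

/-- A RALP solution: a feasible `w` minimizing `∑ s, ρ s * (Φ w)(s)` over feasible vectors. -/
def RALPsolution {k : ℕ} (P : S → A → S → ℝ) (R : S → ℝ) (γ : ℝ)
    (Φ : S → Fin (k + 1) → ℝ) (ψ : ℝ) (ρ : S → ℝ) (w : Fin (k + 1) → ℝ) : Prop :=
  RALPfeasible P R γ Φ ψ w ∧
    ∀ w', RALPfeasible P R γ Φ ψ w' →
      ∑ s, ρ s * phiW Φ w s ≤ ∑ s, ρ s * phiW Φ w' s

end Defs

/-- The map `w ↦ Φ w` is linear. -/
lemma phiW_add_mul {S : Type*} {k : ℕ} (Φ : S → Fin (k + 1) → ℝ) (w v : Fin (k + 1) → ℝ)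
    (c : ℝ) (s : S) : phiW Φ (fun i => w i + c * v i) s = phiW Φ w s + c * phiW Φ v s := by
  simp only [phiW, mul_sum, ← sum_add_distrib]
  exact sum_congr rfl fun i _ => by ring

lemma abs_le_wmaxNorm_mul {S : Type*} [Fintype S] [Nonempty S] {L : S → ℝ} (U : S → ℝ)
    (hL : ∀ s, 0 < L s) (s : S) : |U s| ≤ wmaxNorm L U * L s := by
  rw [← div_le_iff₀ (hL s)]
  exact le_sup' (fun s => |U s| / L s) (mem_univ s)

lemma wmaxNorm_nonneg {S : Type*} [Fintype S] [Nonempty S] {L : S → ℝ} (U : S → ℝ)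
    (hL : ∀ s, 0 < L s) : 0 ≤ wmaxNorm L U :=
  have ⟨s⟩ := ‹Nonempty S›
  nonneg_of_mul_nonneg_left ((abs_nonneg _).trans (abs_le_wmaxNorm_mul U hL s)) (hL s)

/-- If `W ≤ V + d L` pointwise with `d ≥ 0` and `L` satisfies the Lyapunov inequality with rate
`β`, then `T W ≤ T V + d β L`. -/
lemma bellman_le_add_of_le_add {S A : Type*} [Fintype S] [Fintype A] [Nonempty A]
    {P : S → A → S → ℝ} (R : S → ℝ) {γ β d : ℝ} {L V W : S → ℝ} (hγ : 0 ≤ γ)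
    (hP : ∀ s a s', 0 ≤ P s a s') (hL : ∀ s, γ * Hop P L s ≤ β * L s) (hd : 0 ≤ d)
    (hW : ∀ s, W s ≤ V s + d * L s) (s : S) :
    bellman P R γ W s ≤ bellman P R γ V s + d * (β * L s) := by
  refine sup'_le _ _ fun a _ => ?_
  have hV : R s + γ * ∑ s', P s a s' * V s' ≤ bellman P R γ V s :=
    le_sup' (fun a => R s + γ * ∑ s', P s a s' * V s') (mem_univ a)
  have hH : ∑ s', P s a s' * L s' ≤ Hop P L s :=
    le_sup' (fun a => ∑ s', P s a s' * L s') (mem_univ a)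
  calc
    R s + γ * ∑ s', P s a s' * W s' ≤ R s + γ * ∑ s', P s a s' * (V s' + d * L s') := by
      gcongr with s'
      · exact hP s a s'
      · exact hW s'
    _ = (R s + γ * ∑ s', P s a s' * V s') + d * (γ * ∑ s', P s a s' * L s') := by
      simp only [mul_add, sum_add_distrib, mul_left_comm _ d, ← mul_sum]
      ring
    _ ≤ bellman P R γ V s + d * (β * L s) := by
      have := (mul_le_mul_of_nonneg_left hH hγ).trans (hL s)
      gcongr

/-- the shifted vector `w̄ = w + ε(2/(1−β) − 1) w_L` satisfies all Bellman
constraints: `T(Φ w̄)(s) ≤ (Φ w̄)(s)` for every state `s`. -/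
theorem statement_7 {S A : Type*} [Fintype S] [Nonempty S] [Fintype A] [Nonempty A]
    (P : S → A → S → ℝ) (R : S → ℝ) (γ : ℝ) (hγ0 : 0 ≤ γ) (hγ1 : γ < 1)
    (hP0 : ∀ s a s', 0 ≤ P s a s') (hP1 : ∀ s a, ∑ s', P s a s' = 1)
    (Vstar : S → ℝ) (hVstar : ∀ s, bellman P R γ Vstar s = Vstar s)
    {k : ℕ} (Φ : S → Fin (k + 1) → ℝ) (hbias : ∀ s, Φ s 0 = 1)
    (wL : Fin (k + 1) → ℝ) (β : ℝ) (hβ0 : 0 ≤ β) (hβ1 : β < 1)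
    (hLpos : ∀ s, 0 < phiW Φ wL s)
    (hLyap : ∀ s, γ * Hop P (phiW Φ wL) s ≤ β * phiW Φ wL s)
    (w : Fin (k + 1) → ℝ) (ε : ℝ)
    (hε : ε = wmaxNorm (phiW Φ wL) (fun s => Vstar s - phiW Φ w s))
    (wbar : Fin (k + 1) → ℝ)
    (hwbar : wbar = fun i => w i + ε * (2 / (1 - β) - 1) * wL i) :
    ∀ s, bellman P R γ (phiW Φ wbar) s ≤ phiW Φ wbar s := by
  intro s
  have hβ : 0 < 1 - β := by linarith
  have hε0 : 0 ≤ ε := hε ▸ wmaxNorm_nonneg _ hLpos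
  have habs : ∀ s, |Vstar s - phiW Φ w s| ≤ ε * phiW Φ wL s := fun s =>
    hε ▸ abs_le_wmaxNorm_mul (fun s => Vstar s - phiW Φ w s) hLpos s
  have hbar : ∀ s, phiW Φ wbar s = phiW Φ w s + ε * (2 / (1 - β) - 1) * phiW Φ wL s := fun s =>
    hwbar ▸ phiW_add_mul Φ w wL _ s
  have hT := bellman_le_add_of_le_add (d := ε * (2 / (1 - β))) (V := Vstar) (W := phiW Φ wbar)
    R hγ0 hP0 hLyap (by positivity)
    (fun s => by rw [hbar]; linarith [(abs_le.mp (habs s)).1]) s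
  have hcoef : ε + ε * (2 / (1 - β)) * β = ε * (2 / (1 - β) - 1) := by
    field_simp
    ring
  calc
    bellman P R γ (phiW Φ wbar) s ≤ Vstar s + ε * (2 / (1 - β)) * (β * phiW Φ wL s) :=
      hVstar s ▸ hT
    _ ≤ phiW Φ w s + (ε + ε * (2 / (1 - β)) * β) * phiW Φ wL s := by
      linarith [(abs_le.mp (habs s)).2]
    _ = phiW Φ wbar s := by rw [hcoef, hbar]
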